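/- Let (Λ,d) be a finitely aligned k-graph and let {t_λ : λ ∈ (⋃_{i=1}^{k} Λ^{e_i}) ∪ Λ^0} be a family of partial isometries in a C*-algebra, indexed by the edges and vertices of Λ. Then there is at most one Cuntz–Krieger Λ-family {t'_λ : λ ∈ Λ} with t'_λ = t_λ for all λ ∈ (⋃_{i=1}^{k} Λ^{e_i}) ∪ Λ^0. Moreover, such a Cuntz–Krieger Λ-family exists if and only if: (i) {t_v : v ∈ Λ^0} are mutually orthogonal projections; (ii) t_λ t_α = t_μ t_β whenever λ, μ, α, β ∈ (⋃_{i=1}^{k} Λ^{e_i}) ∪ Λ^0 satisfy λα = μβ; (iii) t_λ* t_μ = Σ_{(α,β) ∈ Λ^min(λ,μ)} t_α t_β* for all edges λ,μ ∈ ⋃_{i=1}^{k} Λ^{e_i}; and (iv) ∏_{λ ∈ E} (t_v − t_λ t_λ*) = 0 for every vertex v and every finite exhaustive E ⊆ ⋃_{i=1}^{k} vΛ^{e_i}. -/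

import Mathlib

open scoped BigOperators

/-- A `k`-graph: a countable small category (in arrows-only presentation, with objects
identified with the identity morphisms) together with a degree functor into `ℕ^k`
satisfying the factorisation property.  `comp l m` is the composite path `lm`
(first `m`, then `l` in categorical order; range `rng l`, source `src m`), and is
only meaningful when `src l = rng m`. -/
structure KGraph (k : ℕ) where
  Path : Type
  countable : Countable Path
  src : Path → Path
  rng : Path → Path
  comp : Path → Path → Path
  deg : Path → Fin k → ℕ
  deg_src : ∀ l, deg (src l) = 0
  deg_rng : ∀ l, deg (rng l) = 0
  src_eq_of_deg_zero : ∀ v, deg v = 0 → src v = v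
  rng_eq_of_deg_zero : ∀ v, deg v = 0 → rng v = v
  comp_src_self : ∀ l, comp l (src l) = l
  rng_comp_self : ∀ l, comp (rng l) l = l
  src_comp : ∀ l m, src l = rng m → src (comp l m) = src m
  rng_comp : ∀ l m, src l = rng m → rng (comp l m) = rng l
  deg_comp : ∀ l m, src l = rng m → deg (comp l m) = deg l + deg m
  comp_assoc : ∀ l m n, src l = rng m → src m = rng n →
    comp (comp l m) n = comp l (comp m n)
  factorisation : ∀ (l : Path) (m n : Fin k → ℕ), deg l = m + n →
    ∃! p : Path × Path, deg p.1 = m ∧ deg p.2 = n ∧ src p.1 = rng p.2 ∧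
      comp p.1 p.2 = l

namespace KGraph

variable {k : ℕ} (Λ : KGraph k)

/-- The vertices of a `k`-graph are the paths of degree `0`. -/
def IsVertex (v : Λ.Path) : Prop := Λ.deg v = 0

/-- An edge is a path of degree `e_i` for some `i`. -/
def IsEdge (e : Λ.Path) : Prop := ∃ i : Fin k, Λ.deg e = Pi.single i 1

/-- `vΛ`, the set of paths with range `v`. -/
def withRange (v : Λ.Path) : Set Λ.Path := {l | Λ.rng l = v}

/-- `Λ^min(l,m)`, the set of pairs giving minimal common extensions of `l` and `m`. -/
def minExt (l m : Λ.Path) : Set (Λ.Path × Λ.Path) :=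
  {p | Λ.src l = Λ.rng p.1 ∧ Λ.src m = Λ.rng p.2 ∧
    Λ.comp l p.1 = Λ.comp m p.2 ∧ Λ.deg (Λ.comp l p.1) = Λ.deg l ⊔ Λ.deg m}

/-- A `k`-graph is finitely aligned if all the sets `Λ^min(l,m)` are finite. -/
def FinitelyAligned : Prop := ∀ l m, (Λ.minExt l m).Finite

/-- A subset `E ⊆ vΛ` is exhaustive if every path in `vΛ` has a common extension
with some member of `E`. -/
def Exhaustive (v : Λ.Path) (E : Set Λ.Path) : Prop :=
  ∀ m ∈ Λ.withRange v, ∃ l ∈ E, (Λ.minExt l m).Nonempty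

/-- `Λ^{≤ n}`. -/
def degLe (n : Fin k → ℕ) : Set Λ.Path :=
  {l | Λ.deg l ≤ n ∧ ∀ i : Fin k, Λ.deg l i < n i →
    ¬∃ e, Λ.rng e = Λ.src l ∧ Λ.deg e = Pi.single i 1}

end KGraph

open Classical in
/-- The sum of `f` over a set `S`, defined to be `0` if `S` is infinite. -/
noncomputable def setSum {ι A : Type*} [AddCommMonoid A] (S : Set ι) (f : ι → A) : A :=
  if h : S.Finite then ∑ i ∈ h.toFinset, f i else 0

open Classical in
/-- The product of `f` over a set `S` taken in an arbitrary (but fixed) order,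
defined to be `1` if `S` is infinite.  All products appearing below have commuting
factors, for which this is the usual product over a finite set. -/
noncomputable def setProd {ι A : Type*} [Monoid A] (S : Set ι) (f : ι → A) : A :=
  if h : S.Finite then (h.toFinset.toList.map f).prod else 1

namespace KGraph

variable {k : ℕ} (Λ : KGraph k) {A : Type*} [Ring A] [StarRing A]

/-- Relations (CK1)–(CK3) for a family of partial isometries indexed by a `k`-graph. -/
structure IsCK13 (t : Λ.Path → A) : Prop where
  partialIsometry : ∀ l, t l * star (t l) * t l = t l
  vertex_projection : ∀ v, Λ.IsVertex v → star (t v) = t v ∧ t v * t v = t v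
  vertex_orthogonal : ∀ v w, Λ.IsVertex v → Λ.IsVertex w → v ≠ w → t v * t w = 0
  comp_mul : ∀ l m, Λ.src l = Λ.rng m → t l * t m = t (Λ.comp l m)
  ck3 : ∀ l m, star (t l) * t m =
    setSum (Λ.minExt l m) fun p => t p.1 * star (t p.2)

/-- A Cuntz–Krieger `Λ`-family: relations (CK1)–(CK4). -/
structure IsCKFamily (t : Λ.Path → A) extends IsCK13 Λ t : Prop where
  ck4 : ∀ v E, Λ.IsVertex v → E ⊆ Λ.withRange v → E.Finite → Λ.Exhaustive v E →
    setProd E (fun l => t v - t l * star (t l)) = 0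

/-- Condition (†) on a subset `F ⊆ Λ`. -/
def DaggerClosed (F : Set Λ.Path) : Prop :=
  ∀ l m σ τ a b, l ∈ F → m ∈ F → σ ∈ F → τ ∈ F →
    Λ.deg l = Λ.deg m → Λ.deg σ = Λ.deg τ →
    Λ.src l = Λ.src m → Λ.src σ = Λ.src τ →
    (a, b) ∈ Λ.minExt m σ → Λ.comp l a ∈ F ∧ Λ.comp τ b ∈ F

/-- `ΠE`, the smallest subset of `Λ` containing `E` and satisfying (†). -/
def piSet (E : Set Λ.Path) : Set Λ.Path := ⋂₀ {F | E ⊆ F ∧ Λ.DaggerClosed F}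

/-- For `P ⊆ Λ` and a path `l`, the set `{ν ∈ s(l)Λ : d(ν) > 0 and lν ∈ P}`;
with `P = ΠE` this is the set `T(l)`. -/
def extInto (P : Set Λ.Path) (l : Λ.Path) : Set Λ.Path :=
  {ν | Λ.src l = Λ.rng ν ∧ Λ.deg ν ≠ 0 ∧ Λ.comp l ν ∈ P}

/-- The projection `Q(t)^{ΠE}_l`. -/
noncomputable def Qproj (t : Λ.Path → A) (E : Set Λ.Path) (l : Λ.Path) : A :=
  t l * star (t l) *
    setProd (Λ.extInto (Λ.piSet E) l)
      (fun ν => t l * star (t l) - t (Λ.comp l ν) * star (t (Λ.comp l ν)))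

/-- The matrix unit `Θ(t,E;l,m) = Q(t)^{ΠE}_l t_l t_m^*`. -/
noncomputable def Theta (t : Λ.Path → A) (E : Set Λ.Path) (l m : Λ.Path) : A :=
  Λ.Qproj t E l * (t l * star (t m))

end KGraph

/-- A degree-preserving functor `x : Ω_{k,m} → Λ` for some `m ∈ (ℕ ∪ {∞})^k`,
recorded by its degree `m` and its values `map p q` on the morphisms `(p,q)` of
`Ω_{k,m}` (normalised to the junk value `map 0 0` on pairs `(p,q)` that are not
morphisms of `Ω_{k,m}`). -/
structure OmegaMor {k : ℕ} (Λ : KGraph k) where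
  m : Fin k → ℕ∞
  map : (Fin k → ℕ) → (Fin k → ℕ) → Λ.Path
  deg_map : ∀ p q : Fin k → ℕ, p ≤ q → (∀ i, (q i : ℕ∞) ≤ m i) →
    Λ.deg (map p q) = q - p
  rng_map : ∀ p q : Fin k → ℕ, p ≤ q → (∀ i, (q i : ℕ∞) ≤ m i) →
    Λ.rng (map p q) = map p p
  src_map : ∀ p q : Fin k → ℕ, p ≤ q → (∀ i, (q i : ℕ∞) ≤ m i) →
    Λ.src (map p q) = map q q
  comp_map : ∀ p q r : Fin k → ℕ, p ≤ q → q ≤ r → (∀ i, (r i : ℕ∞) ≤ m i) →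
    Λ.comp (map p q) (map q r) = map p r
  map_default : ∀ p q : Fin k → ℕ, ¬(p ≤ q ∧ ∀ i, (q i : ℕ∞) ≤ m i) →
    map p q = map 0 0

/-- `x` is a boundary path: there is `n_x ≤ m` such that whenever `n_x ≤ n ≤ m`
and `n_i = m_i`, the vertex `x(n)` receives no edge of degree `e_i`. -/
def OmegaMor.IsBoundary {k : ℕ} {Λ : KGraph k} (x : OmegaMor Λ) : Prop :=
  ∃ nx : Fin k → ℕ, (∀ i, (nx i : ℕ∞) ≤ x.m i) ∧
    ∀ n : Fin k → ℕ, nx ≤ n → (∀ i, (n i : ℕ∞) ≤ x.m i) →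
      ∀ i : Fin k, (n i : ℕ∞) = x.m i →
        ¬∃ e, Λ.rng e = x.map n n ∧ Λ.deg e = Pi.single i 1

theorem setSum_eq_sum {ι A : Type*} [AddCommMonoid A] {S : Set ι} (h : S.Finite) (f : ι → A) :
    setSum S f = ∑ i ∈ h.toFinset, f i := by
  rw [setSum, dif_pos h]

theorem setSum_singleton {ι A : Type*} [AddCommMonoid A] (a : ι) (f : ι → A) :
    setSum {a} f = f a := by
  simp [setSum]

theorem setSum_empty {ι A : Type*} [AddCommMonoid A] (f : ι → A) :
    setSum ∅ f = 0 := by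
  simp [setSum]

theorem setSum_congr {ι A : Type*} [AddCommMonoid A] {S : Set ι} {f g : ι → A}
    (h : ∀ i ∈ S, f i = g i) : setSum S f = setSum S g := by
  unfold setSum
  split_ifs with hS
  · exact Finset.sum_congr rfl fun i hi => h i (hS.mem_toFinset.1 hi)
  · rfl

theorem setProd_congr {ι A : Type*} [Monoid A] {S : Set ι} {f g : ι → A}
    (h : ∀ i ∈ S, f i = g i) : setProd S f = setProd S g := by
  unfold setProd
  split_ifs with hS
  · congr 1
    exact List.map_congr_left fun i hi => h i (by simpa using hi)
  · rfl

namespace KGraph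

section Paths

variable {k : ℕ} {Λ : KGraph k}

theorem rng_src (l : Λ.Path) : Λ.rng (Λ.src l) = Λ.src l :=
  Λ.rng_eq_of_deg_zero _ (Λ.deg_src l)

theorem src_rng (l : Λ.Path) : Λ.src (Λ.rng l) = Λ.rng l :=
  Λ.src_eq_of_deg_zero _ (Λ.deg_rng l)

theorem comp_inj {l m l' m' : Λ.Path} (h : Λ.src l = Λ.rng m) (h' : Λ.src l' = Λ.rng m')
    (hd : Λ.deg l = Λ.deg l') (hc : Λ.comp l m = Λ.comp l' m') : l = l' ∧ m = m' := by
  have hm : Λ.deg m = Λ.deg m' := by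
    have h1 := Λ.deg_comp l m h
    rw [hc, Λ.deg_comp l' m' h', hd] at h1
    exact (add_left_cancel h1).symm
  have := (Λ.factorisation (Λ.comp l m) _ _ (Λ.deg_comp l m h)).unique
    (y₁ := (l, m)) (y₂ := (l', m')) ⟨rfl, rfl, h, rfl⟩ ⟨hd.symm, hm.symm, h', hc.symm⟩
  exact ⟨congrArg Prod.fst this, congrArg Prod.snd this⟩

theorem exists_factor (l : Λ.Path) (m n : Fin k → ℕ) (h : Λ.deg l = m + n) :
    ∃ a b, Λ.deg a = m ∧ Λ.deg b = n ∧ Λ.src a = Λ.rng b ∧ Λ.comp a b = l := by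
  obtain ⟨p, hp, -⟩ := Λ.factorisation l m n h
  exact ⟨p.1, p.2, hp⟩

theorem exists_factor_of_le (l : Λ.Path) (m : Fin k → ℕ) (h : m ≤ Λ.deg l) :
    ∃ a b, Λ.deg a = m ∧ Λ.src a = Λ.rng b ∧ Λ.comp a b = l := by
  obtain ⟨a, b, ha, -, hb⟩ := exists_factor l m (Λ.deg l - m) (add_tsub_cancel_of_le h).symm
  exact ⟨a, b, ha, hb⟩

theorem single_one_le {i : Fin k} {n : Fin k → ℕ} (h : 1 ≤ n i) : Pi.single i 1 ≤ n := by
  intro j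
  by_cases hj : j = i
  · rw [hj, Pi.single_eq_same]
    exact h
  · rw [Pi.single_eq_of_ne hj]
    exact Nat.zero_le _

theorem exists_edge_factor (l : Λ.Path) (h : ¬ Λ.IsVertex l) :
    ∃ e m, Λ.IsEdge e ∧ Λ.src e = Λ.rng m ∧ Λ.comp e m = l := by
  obtain ⟨i, hi⟩ := Function.ne_iff.1 h
  obtain ⟨a, b, ha, hb⟩ := exists_factor_of_le l (Pi.single i 1)
    (single_one_le (Nat.one_le_iff_ne_zero.2 hi))
  exact ⟨a, b, ⟨i, ha⟩, hb⟩

theorem sum_deg_comp_edge {e m : Λ.Path} (he : Λ.IsEdge e) (h : Λ.src e = Λ.rng m) :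
    ∑ i, Λ.deg (Λ.comp e m) i = ∑ i, Λ.deg m i + 1 := by
  obtain ⟨i, hi⟩ := he
  simp [Λ.deg_comp e m h, hi, Finset.sum_add_distrib, add_comm]

theorem isVertex_iff_sum_deg {l : Λ.Path} : Λ.IsVertex l ↔ ∑ i, Λ.deg l i = 0 := by
  simp [IsVertex, funext_iff]

theorem edge_induction {P : Λ.Path → Prop} (hv : ∀ v, Λ.IsVertex v → P v)
    (he : ∀ e m, Λ.IsEdge e → Λ.src e = Λ.rng m → P m → P (Λ.comp e m)) (l : Λ.Path) : P l := by
  induction hn : ∑ i, Λ.deg l i generalizing l with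
  | zero => exact hv l (isVertex_iff_sum_deg.2 hn)
  | succ n ih =>
    obtain ⟨e, m, h1, h2, rfl⟩ := exists_edge_factor l (by
      rw [isVertex_iff_sum_deg]; omega)
    rw [sum_deg_comp_edge h1 h2] at hn
    exact he e m h1 h2 (ih m (by omega))

theorem edge_swap {e f m n : Λ.Path} (he : Λ.IsEdge e) (hf : Λ.IsEdge f)
    (hem : Λ.src e = Λ.rng m) (hfn : Λ.src f = Λ.rng n) (h : Λ.comp e m = Λ.comp f n) :
    (e = f ∧ m = n) ∨ ∃ e' f' r, Λ.IsEdge e' ∧ Λ.IsEdge f' ∧ Λ.src f' = Λ.rng r ∧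
      Λ.src e' = Λ.rng r ∧ m = Λ.comp f' r ∧ n = Λ.comp e' r ∧ Λ.src e = Λ.rng f' ∧
      Λ.src f = Λ.rng e' ∧ Λ.comp e f' = Λ.comp f e' := by
  obtain ⟨i, hi⟩ := he
  obtain ⟨j, hj⟩ := hf
  by_cases hij : i = j
  · subst hij
    exact Or.inl (comp_inj hem hfn (hi.trans hj.symm) h)
  right
  have hd : Pi.single i 1 + Λ.deg m = Pi.single j 1 + Λ.deg n := by
    rw [← hi, ← hj, ← Λ.deg_comp e m hem, ← Λ.deg_comp f n hfn, h]
  obtain ⟨f', r, hf', hr, rfl⟩ := exists_factor_of_le m (Pi.single j 1) (by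
    have := congrFun hd j
    simp only [Pi.add_apply, Pi.single_eq_same, Pi.single_eq_of_ne' hij] at this
    exact single_one_le (by omega))
  rw [Λ.deg_comp _ _ hr, hf'] at hd
  obtain ⟨e', r', he', hdr, hr', rfl⟩ := exists_factor n (Pi.single i 1) (Λ.deg r) (by
    refine add_left_cancel (hd.symm.trans ?_)
    abel)
  rw [Λ.rng_comp _ _ hr] at hem
  rw [Λ.rng_comp _ _ hr'] at hfn
  rw [← Λ.comp_assoc _ _ _ hem hr, ← Λ.comp_assoc _ _ _ hfn hr'] at h
  obtain ⟨h1, rfl⟩ := comp_inj ((Λ.src_comp _ _ hem).trans hr) ((Λ.src_comp _ _ hfn).trans hr')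
    (by rw [Λ.deg_comp _ _ hem, Λ.deg_comp _ _ hfn, hi, hj, he', hf', add_comm]) h
  exact ⟨e', f', r, ⟨i, he'⟩, ⟨j, hf'⟩, hr, hr', rfl, rfl, hem, hfn, h1⟩

theorem exists_minExt_of_comp_eq {l m a b : Λ.Path} (hla : Λ.src l = Λ.rng a)
    (hmb : Λ.src m = Λ.rng b) (h : Λ.comp l a = Λ.comp m b) :
    ∃ α β r, (α, β) ∈ Λ.minExt l m ∧ Λ.src α = Λ.rng r ∧ Λ.src β = Λ.rng r ∧
      a = Λ.comp α r ∧ b = Λ.comp β r := by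
  have hd : Λ.deg l + Λ.deg a = Λ.deg m + Λ.deg b := by
    rw [← Λ.deg_comp _ _ hla, ← Λ.deg_comp _ _ hmb, h]
  obtain ⟨α, r, hα, hr, rfl⟩ := exists_factor_of_le a (Λ.deg l ⊔ Λ.deg m - Λ.deg l) (by
    intro i
    have := congrFun hd i
    simp only [Pi.add_apply, Pi.sub_apply, Pi.sup_apply] at this ⊢
    omega)
  rw [Λ.deg_comp _ _ hr, hα] at hd
  obtain ⟨β, r', hβ, hdr, hr', rfl⟩ := exists_factor b (Λ.deg l ⊔ Λ.deg m - Λ.deg m) (Λ.deg r) (by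
    ext i
    have := congrFun hd i
    simp only [Pi.add_apply, Pi.sub_apply, Pi.sup_apply] at this ⊢
    omega)
  rw [Λ.rng_comp _ _ hr] at hla
  rw [Λ.rng_comp _ _ hr'] at hmb
  rw [← Λ.comp_assoc _ _ _ hla hr, ← Λ.comp_assoc _ _ _ hmb hr'] at h
  have hdl : Λ.deg (Λ.comp l α) = Λ.deg l ⊔ Λ.deg m := by
    rw [Λ.deg_comp _ _ hla, hα, add_tsub_cancel_of_le le_sup_left]
  obtain ⟨h1, rfl⟩ := comp_inj ((Λ.src_comp _ _ hla).trans hr) ((Λ.src_comp _ _ hmb).trans hr')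
    (by rw [hdl, Λ.deg_comp _ _ hmb, hβ, add_tsub_cancel_of_le le_sup_right]) h
  exact ⟨α, β, r, ⟨hla, hmb, h1, hdl⟩, hr, hr', rfl, rfl⟩

theorem mem_minExt_swap {l m a b : Λ.Path} (h : (a, b) ∈ Λ.minExt l m) :
    (b, a) ∈ Λ.minExt m l := by
  obtain ⟨h1, h2, h3, h4⟩ := h
  exact ⟨h2, h1, h3.symm, h3 ▸ sup_comm (Λ.deg m) (Λ.deg l) ▸ h4⟩

theorem deg_fst_of_mem_minExt {l m a b : Λ.Path} (h : (a, b) ∈ Λ.minExt l m) :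
    Λ.deg l + Λ.deg a = Λ.deg l ⊔ Λ.deg m := by
  rw [← Λ.deg_comp _ _ h.1]
  exact h.2.2.2

theorem deg_snd_of_mem_minExt {l m a b : Λ.Path} (h : (a, b) ∈ Λ.minExt l m) :
    Λ.deg m + Λ.deg b = Λ.deg l ⊔ Λ.deg m := by
  rw [sup_comm]
  exact deg_fst_of_mem_minExt (mem_minExt_swap h)

theorem src_eq_of_mem_minExt {l m a b : Λ.Path} (h : (a, b) ∈ Λ.minExt l m) :
    Λ.src a = Λ.src b := by
  have := congrArg Λ.src h.2.2.1
  rwa [Λ.src_comp _ _ h.1, Λ.src_comp _ _ h.2.1] at this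

theorem fst_vertex_or_edge_of_mem_minExt {l m a b : Λ.Path} (h : (a, b) ∈ Λ.minExt l m)
    (hm : Λ.IsVertex m ∨ Λ.IsEdge m) : Λ.IsVertex a ∨ Λ.IsEdge a := by
  have hd := deg_fst_of_mem_minExt h
  have hle : Λ.deg a ≤ Λ.deg m := fun i => by
    have := congrFun hd i
    simp only [Pi.add_apply, Pi.sup_apply] at this
    change Λ.deg a i ≤ Λ.deg m i
    omega
  rcases hm with hm | ⟨i, hi⟩
  · rw [hm] at hle
    exact Or.inl (le_antisymm hle (fun _ => Nat.zero_le _))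
  rw [hi] at hle
  have h0 : ∀ j, j ≠ i → Λ.deg a j = 0 := fun j hj => by
    have := hle j
    rw [Pi.single_eq_of_ne hj] at this
    exact Nat.le_zero.1 this
  have h1 := hle i
  rw [Pi.single_eq_same] at h1
  rcases Nat.le_one_iff_eq_zero_or_eq_one.1 h1 with h1 | h1
  · left
    ext j
    by_cases hj : j = i
    · rw [hj]; exact h1
    · exact h0 j hj
  · right
    refine ⟨i, ?_⟩
    ext j
    by_cases hj : j = i
    · rw [hj, h1, Pi.single_eq_same]
    · rw [h0 j hj, Pi.single_eq_of_ne hj]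

theorem snd_vertex_or_edge_of_mem_minExt {l m a b : Λ.Path} (h : (a, b) ∈ Λ.minExt l m)
    (hl : Λ.IsVertex l ∨ Λ.IsEdge l) : Λ.IsVertex b ∨ Λ.IsEdge b :=
  fst_vertex_or_edge_of_mem_minExt (mem_minExt_swap h) hl

theorem minExt_self (l : Λ.Path) : Λ.minExt l l = {(Λ.src l, Λ.src l)} := by
  ext ⟨a, b⟩
  simp only [Set.mem_singleton_iff, Prod.mk.injEq]
  constructor
  · intro h
    have ha : Λ.deg a = 0 := by simpa using deg_fst_of_mem_minExt h
    have hb : Λ.deg b = 0 := by simpa using deg_snd_of_mem_minExt h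
    exact ⟨(h.1.trans (Λ.rng_eq_of_deg_zero a ha)).symm,
      (h.2.1.trans (Λ.rng_eq_of_deg_zero b hb)).symm⟩
  · rintro ⟨rfl, rfl⟩
    exact ⟨(rng_src l).symm, (rng_src l).symm, rfl, by simp [Λ.comp_src_self]⟩

theorem minExt_rng (m : Λ.Path) : Λ.minExt (Λ.rng m) m = {(m, Λ.src m)} := by
  ext ⟨a, b⟩
  simp only [Set.mem_singleton_iff, Prod.mk.injEq]
  constructor
  · intro h
    have hb : Λ.deg b = 0 := by simpa [Λ.deg_rng] using deg_snd_of_mem_minExt h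
    have hb' : b = Λ.src m := by rw [h.2.1, Λ.rng_eq_of_deg_zero b hb]
    have h1 : Λ.src (Λ.rng m) = Λ.rng a := h.1
    have h2 : Λ.comp (Λ.rng m) a = Λ.comp m b := h.2.2.1
    rw [src_rng] at h1
    rw [h1, Λ.rng_comp_self, hb', Λ.comp_src_self] at h2
    exact ⟨h2, hb'⟩
  · rintro ⟨rfl, rfl⟩
    exact ⟨src_rng _, (rng_src _).symm, by rw [Λ.rng_comp_self, Λ.comp_src_self],
      by simp [Λ.rng_comp_self, Λ.deg_rng]⟩

theorem minExt_comp_mk {l l' m a b c d : Λ.Path} (hl : Λ.src l = Λ.rng l')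
    (h : (a, b) ∈ Λ.minExt l m) (h' : (c, d) ∈ Λ.minExt l' a) :
    Λ.src b = Λ.rng d ∧ (c, Λ.comp b d) ∈ Λ.minExt (Λ.comp l l') m := by
  have hbd : Λ.src b = Λ.rng d := (src_eq_of_mem_minExt h).symm.trans h'.2.1
  have h1 := deg_fst_of_mem_minExt h
  have h2 := deg_fst_of_mem_minExt h'
  obtain ⟨hla, hmb, he, -⟩ := h
  obtain ⟨hlc, had, he', -⟩ := h'
  dsimp only at *
  have hsc : Λ.src (Λ.comp l l') = Λ.rng c := (Λ.src_comp _ _ hl).trans hlc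
  refine ⟨hbd, hsc, hmb.trans (Λ.rng_comp _ _ hbd).symm, ?_, ?_⟩
  · dsimp only
    rw [Λ.comp_assoc _ _ _ hl hlc, he', ← Λ.comp_assoc _ _ _ hla had, he,
      Λ.comp_assoc _ _ _ hmb hbd]
  · dsimp only
    rw [Λ.deg_comp _ _ hsc, Λ.deg_comp _ _ hl]
    ext i
    have h1 := congrFun h1 i
    have h2 := congrFun h2 i
    simp only [Pi.add_apply, Pi.sup_apply] at h1 h2 ⊢
    omega

theorem minExt_comp_surj {l l' m c x : Λ.Path} (hl : Λ.src l = Λ.rng l')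
    (h : (c, x) ∈ Λ.minExt (Λ.comp l l') m) :
    ∃ a b d, (a, b) ∈ Λ.minExt l m ∧ (c, d) ∈ Λ.minExt l' a ∧ x = Λ.comp b d := by
  have hd := deg_fst_of_mem_minExt h
  obtain ⟨hlc, hmx, he, -⟩ := h
  dsimp only at *
  rw [Λ.deg_comp _ _ hl] at hd
  have hlc' : Λ.src l' = Λ.rng c := (Λ.src_comp _ _ hl).symm.trans hlc
  rw [Λ.comp_assoc _ _ _ hl hlc'] at he
  obtain ⟨a, b, d, hab, had, hbd, h1, h2⟩ :=
    exists_minExt_of_comp_eq (hl.trans (Λ.rng_comp _ _ hlc').symm) hmx he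
  refine ⟨a, b, d, hab, ⟨hlc', had, h1, ?_⟩, h2⟩
  have h3 := deg_fst_of_mem_minExt hab
  dsimp only
  rw [Λ.deg_comp _ _ hlc']
  ext i
  have h3 := congrFun h3 i
  have hd := congrFun hd i
  simp only [Pi.add_apply, Pi.sup_apply] at hd h3 ⊢
  omega

theorem minExt_comp_inj {l m a b d a' b' d' : Λ.Path} (h : (a, b) ∈ Λ.minExt l m)
    (h' : (a', b') ∈ Λ.minExt l m) (hbd : Λ.src b = Λ.rng d) (hbd' : Λ.src b' = Λ.rng d')
    (he : Λ.comp b d = Λ.comp b' d') : a = a' ∧ b = b' ∧ d = d' := by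
  have hdb : Λ.deg b = Λ.deg b' :=
    add_left_cancel ((deg_snd_of_mem_minExt h).trans (deg_snd_of_mem_minExt h').symm)
  obtain ⟨rfl, rfl⟩ := comp_inj hbd hbd' hdb he
  exact ⟨(comp_inj h.1 h'.1 rfl (h.2.2.1.trans h'.2.2.1.symm)).2, rfl, rfl⟩

/-- The paths completing `l` to a minimal common extension with a member of `E`. -/
def extSet (E : Set Λ.Path) (l : Λ.Path) : Set Λ.Path :=
  {a | ∃ m ∈ E, ∃ b, (a, b) ∈ Λ.minExt l m}

theorem FinitelyAligned.finite_extSet (hΛ : Λ.FinitelyAligned) {E : Set Λ.Path} (hE : E.Finite)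
    (l : Λ.Path) : (extSet E l).Finite := by
  refine (hE.biUnion fun m _ => (hΛ l m).image Prod.fst).subset ?_
  rintro a ⟨m, hm, b, hab⟩
  simp only [Set.mem_iUnion]
  exact ⟨m, hm, (a, b), hab, rfl⟩

theorem extSet_subset_withRange (E : Set Λ.Path) (l : Λ.Path) :
    extSet E l ⊆ Λ.withRange (Λ.src l) := by
  rintro a ⟨m, -, b, hab⟩
  exact hab.1.symm

theorem Exhaustive.extSet {v l : Λ.Path} {E : Set Λ.Path} (hE : Λ.Exhaustive v E)
    (hl : Λ.rng l = v) : Λ.Exhaustive (Λ.src l) (extSet E l) := by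
  intro m hm
  have hlm : Λ.src l = Λ.rng m := hm.symm
  obtain ⟨n, hn, ⟨p, q⟩, hp, hq, he, -⟩ := hE (Λ.comp l m) ((Λ.rng_comp _ _ hlm).trans hl)
  dsimp only at *
  rw [Λ.src_comp _ _ hlm] at hq
  rw [Λ.comp_assoc _ _ _ hlm hq] at he
  obtain ⟨α, β, r, hαβ, hα, -, h1, -⟩ :=
    exists_minExt_of_comp_eq (hlm.trans (Λ.rng_comp _ _ hq).symm) hp he.symm
  obtain ⟨x, y, -, hxy, -⟩ := exists_minExt_of_comp_eq hα hq h1.symm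
  exact ⟨α, ⟨n, hn, β, hαβ⟩, (x, y), hxy⟩

theorem Exhaustive.image_initial {v : Λ.Path} {E : Set Λ.Path} (hE : Λ.Exhaustive v E)
    {f g : Λ.Path → Λ.Path} (hfg : ∀ l ∈ E, Λ.src (f l) = Λ.rng (g l))
    (hc : ∀ l ∈ E, Λ.comp (f l) (g l) = l) : Λ.Exhaustive v (f '' E) := by
  intro m hm
  obtain ⟨l, hl, ⟨a, b⟩, ha, hb, he, -⟩ := hE m hm
  dsimp only at *
  have hga : Λ.src (g l) = Λ.rng a := by rw [← ha, ← Λ.src_comp _ _ (hfg l hl), hc l hl]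
  rw [← hc l hl, Λ.comp_assoc _ _ _ (hfg l hl) hga] at he
  obtain ⟨x, y, -, hxy, -⟩ :=
    exists_minExt_of_comp_eq ((hfg l hl).trans (Λ.rng_comp _ _ hga).symm) hb he
  exact ⟨f l, ⟨l, hl, rfl⟩, (x, y), hxy⟩

end Paths

section Families

variable {k : ℕ} {Λ : KGraph k} {A : Type*} [Ring A]

/-- The product of `t` over the edges of a chosen factorisation of `l`, truncated after `n`
edges. -/
noncomputable def edgeProd (t : Λ.Path → A) : ℕ → Λ.Path → A
  | 0, l => t l
  | n + 1, l => by
    classical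
    exact if h : Λ.IsVertex l then t l else
      t (exists_edge_factor l h).choose *
        edgeProd t n (exists_edge_factor l h).choose_spec.choose

theorem edgeProd_succ (t : Λ.Path → A) (n : ℕ) {l : Λ.Path} (h : ¬ Λ.IsVertex l) :
    edgeProd t (n + 1) l = t (exists_edge_factor l h).choose *
      edgeProd t n (exists_edge_factor l h).choose_spec.choose := by
  simp only [edgeProd, dif_neg h]

theorem exists_edge_mul {t : Λ.Path → A}
    (ht : ∀ e f a b, Λ.IsEdge e → Λ.IsEdge f → Λ.IsEdge a → Λ.IsEdge b → Λ.src e = Λ.rng a →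
      Λ.src f = Λ.rng b → Λ.comp e a = Λ.comp f b → t e * t a = t f * t b) :
    ∃ T : Λ.Path → A, (∀ v, Λ.IsVertex v → T v = t v) ∧
      ∀ e m, Λ.IsEdge e → Λ.src e = Λ.rng m → T (Λ.comp e m) = t e * T m := by
  refine ⟨fun l => edgeProd t (∑ i, Λ.deg l i) l, ?_, ?_⟩
  · intro v hv
    simp only [isVertex_iff_sum_deg.1 hv, edgeProd]
  suffices H : ∀ n e m, Λ.IsEdge e → Λ.src e = Λ.rng m → ∑ i, Λ.deg m i = n →
      edgeProd t (n + 1) (Λ.comp e m) = t e * edgeProd t n m by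
    intro e m he hem
    simp only [sum_deg_comp_edge he hem]
    exact H _ e m he hem rfl
  intro n
  induction n with
  | zero => ?_
  | succ n ih => ?_
  all_goals
    intro e m he hem hn
    have hv : ¬ Λ.IsVertex (Λ.comp e m) := by
      rw [isVertex_iff_sum_deg, sum_deg_comp_edge he hem]
      omega
    rw [edgeProd_succ t _ hv]
    obtain ⟨h1, h2, h3⟩ := (exists_edge_factor _ hv).choose_spec.choose_spec
    generalize (exists_edge_factor _ hv).choose_spec.choose = g at h1 h2 h3 ⊢
    generalize (exists_edge_factor _ hv).choose = f at h1 h2 h3 ⊢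
    rcases edge_swap he h1 hem h2 h3.symm with
      ⟨rfl, rfl⟩ | ⟨e', f', r, he', hf', hfr, her, rfl, rfl, hef, hfe, hc⟩
    · rfl
    rw [sum_deg_comp_edge hf' hfr] at hn
  · omega
  · rw [ih e' r he' her (by omega), ih f' r hf' hfr (by omega), ← mul_assoc, ← mul_assoc,
      ht e f f' e' he h1 hf' he' hef hfe hc]

variable [StarRing A]

/-- The relation (CK3) for a single pair of paths. -/
def CK3At (t : Λ.Path → A) (l m : Λ.Path) : Prop :=
  star (t l) * t m = setSum (Λ.minExt l m) fun p => t p.1 * star (t p.2)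

theorem CK3At.symm (hΛ : Λ.FinitelyAligned) {t : Λ.Path → A} {l m : Λ.Path}
    (h : CK3At t l m) : CK3At t m l := by
  have h := congrArg star h
  rw [star_mul, star_star, setSum_eq_sum (hΛ l m), star_sum] at h
  rw [CK3At, h, setSum_eq_sum (hΛ m l)]
  refine Finset.sum_nbij' Prod.swap Prod.swap ?_ ?_ ?_ ?_ ?_
  · rintro ⟨a, b⟩ hab
    simp only [Set.Finite.mem_toFinset] at hab ⊢
    exact mem_minExt_swap hab
  · rintro ⟨a, b⟩ hab
    simp only [Set.Finite.mem_toFinset] at hab ⊢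
    exact mem_minExt_swap hab
  · intros; rfl
  · intros; rfl
  · intros; simp

theorem CK3At.comp (hΛ : Λ.FinitelyAligned) {t : Λ.Path → A}
    (ht : ∀ l m, Λ.src l = Λ.rng m → t l * t m = t (Λ.comp l m)) {l l' m : Λ.Path}
    (hl : Λ.src l = Λ.rng l') (h : CK3At t l m)
    (h' : ∀ a b, (a, b) ∈ Λ.minExt l m → CK3At t l' a) : CK3At t (Λ.comp l l') m := by
  rw [CK3At, ← ht _ _ hl, star_mul, mul_assoc, h, setSum_eq_sum (hΛ l m), Finset.mul_sum,
    setSum_eq_sum (hΛ _ m)]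
  have h1 : ∀ p ∈ (hΛ l m).toFinset, star (t l') * (t p.1 * star (t p.2)) =
      ∑ q ∈ (hΛ l' p.1).toFinset, t q.1 * star (t (Λ.comp p.2 q.2)) := by
    rintro ⟨a, b⟩ hab
    rw [Set.Finite.mem_toFinset] at hab
    rw [← mul_assoc, h' a b hab, setSum_eq_sum (hΛ l' a), Finset.sum_mul]
    refine Finset.sum_congr rfl ?_
    rintro ⟨c, d⟩ hcd
    rw [Set.Finite.mem_toFinset] at hcd
    rw [← ht _ _ (minExt_comp_mk hl hab hcd).1, star_mul, mul_assoc]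
  rw [Finset.sum_congr rfl h1, Finset.sum_sigma']
  refine Finset.sum_nbij (fun x => (x.2.1, Λ.comp x.1.2 x.2.2)) ?_ ?_ ?_ ?_
  · rintro ⟨⟨a, b⟩, ⟨c, d⟩⟩ hx
    simp only [Finset.mem_sigma, Set.Finite.mem_toFinset] at hx ⊢
    exact (minExt_comp_mk hl hx.1 hx.2).2
  · rintro ⟨⟨a, b⟩, ⟨c, d⟩⟩ hx ⟨⟨a', b'⟩, ⟨c', d'⟩⟩ hx' he
    simp only [Finset.mem_coe, Finset.mem_sigma, Set.Finite.mem_toFinset] at hx hx'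
    simp only [Prod.mk.injEq] at he
    obtain ⟨rfl, he⟩ := he
    obtain ⟨rfl, rfl, rfl⟩ := minExt_comp_inj hx.1 hx'.1 (minExt_comp_mk hl hx.1 hx.2).1
      (minExt_comp_mk hl hx'.1 hx'.2).1 he
    rfl
  · rintro ⟨c, x⟩ hx
    simp only [Finset.mem_coe, Set.Finite.mem_toFinset] at hx
    obtain ⟨a, b, d, h1, h2, rfl⟩ := minExt_comp_surj hl hx
    refine ⟨⟨(a, b), (c, d)⟩, ?_, rfl⟩
    simp only [Finset.mem_coe, Finset.mem_sigma, Set.Finite.mem_toFinset]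
    exact ⟨h1, h2⟩
  · intros; rfl

variable {t : Λ.Path → A}

theorem IsCK13.vertex_mul (ht : IsCK13 Λ t) (l : Λ.Path) : t (Λ.rng l) * t l = t l := by
  rw [ht.comp_mul _ _ (src_rng l), Λ.rng_comp_self]

theorem IsCK13.mul_vertex (ht : IsCK13 Λ t) (l : Λ.Path) : t l * t (Λ.src l) = t l := by
  rw [ht.comp_mul _ _ (rng_src l).symm, Λ.comp_src_self]

theorem IsCK13.star_mul_vertex (ht : IsCK13 Λ t) (l : Λ.Path) :
    star (t l) * t (Λ.rng l) = star (t l) := by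
  have := congrArg star (ht.vertex_mul l)
  rwa [star_mul, (ht.vertex_projection _ (Λ.deg_rng l)).1] at this

theorem IsCK13.vertex_mul_star (ht : IsCK13 Λ t) (l : Λ.Path) :
    t (Λ.src l) * star (t l) = star (t l) := by
  have := congrArg star (ht.mul_vertex l)
  rwa [star_mul, (ht.vertex_projection _ (Λ.deg_src l)).1] at this

theorem IsCK13.range_commute (hΛ : Λ.FinitelyAligned) (ht : IsCK13 Λ t) (l m : Λ.Path) :
    Commute (t l * star (t l)) (t m * star (t m)) := by
  have key : t l * star (t l) * (t m * star (t m)) =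
      ∑ p ∈ (hΛ l m).toFinset, t (Λ.comp l p.1) * star (t (Λ.comp l p.1)) := by
    rw [mul_assoc, ← mul_assoc (star (t l)), ht.ck3, setSum_eq_sum (hΛ l m), Finset.sum_mul,
      Finset.mul_sum]
    refine Finset.sum_congr rfl ?_
    rintro ⟨a, b⟩ hab
    rw [Set.Finite.mem_toFinset] at hab
    have h3 : Λ.comp l a = Λ.comp m b := hab.2.2.1
    rw [mul_assoc (t a), ← star_mul, ← mul_assoc, ht.comp_mul _ _ hab.1, ht.comp_mul _ _ hab.2.1,
      h3]
  have h := congrArg star key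
  simp only [star_mul, star_star, star_sum] at h
  exact key.trans h.symm

/-- The product of the `t v - t l * star (t l)` over `E` vanishes exactly when no nonzero element
lies under `t v` and is orthogonal to the ranges of all `t l`. -/
theorem IsCK13.setProd_eq_zero_iff (hΛ : Λ.FinitelyAligned) (ht : IsCK13 Λ t) {v : Λ.Path}
    {E : Set Λ.Path} (hv : Λ.IsVertex v) (hE : E.Finite) (hne : E.Nonempty)
    (hEv : E ⊆ Λ.withRange v) :
    setProd E (fun l => t v - t l * star (t l)) = 0 ↔
      ∀ x, t v * x = x → (∀ l ∈ E, star (t l) * x = 0) → x = 0 := by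
  rw [setProd, dif_pos hE]
  constructor
  · intro h x hx hxE
    have key : ∀ L : List Λ.Path, (∀ l ∈ L, l ∈ E) →
        (L.map fun l => t v - t l * star (t l)).prod * x = x := by
      intro L hL
      induction L with
      | nil => simp
      | cons a L ih =>
        rw [List.map_cons, List.prod_cons, mul_assoc, ih fun l hl => hL l (by simp [hl]), sub_mul,
          hx, mul_assoc, hxE a (hL a (by simp)), mul_zero, sub_zero]
    rw [← key hE.toFinset.toList (by simp), h, zero_mul]
  · intro h
    have hvv : t v * star (t v) = t v := by
      rw [(ht.vertex_projection v hv).1, (ht.vertex_projection v hv).2]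
    have hrv : ∀ l ∈ E, t v * (t l * star (t l)) = t l * star (t l) := fun l hl => by
      rw [← hEv hl, ← mul_assoc, ht.vertex_mul]
    have hrv' : ∀ l ∈ E, (t l * star (t l)) * t v = t l * star (t l) := fun l hl => by
      rw [← hEv hl, mul_assoc, ht.star_mul_vertex]
    have key : ∀ L : List Λ.Path, ∀ l ∈ E, l ∈ L →
        t l * star (t l) * (L.map fun l => t v - t l * star (t l)).prod = 0 := by
      intro L l hlE hlL
      induction L with
      | nil => simp at hlL
      | cons a L ih =>
        rw [List.map_cons, List.prod_cons, ← mul_assoc]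
        rcases List.mem_cons.1 hlL with rfl | hlL
        · rw [mul_sub, hrv' l hlE, ← mul_assoc, ht.partialIsometry, sub_self, zero_mul]
        · have hc : Commute (t l * star (t l)) (t v - t a * star (t a)) :=
            Commute.sub_right (hvv ▸ ht.range_commute hΛ l v) (ht.range_commute hΛ l a)
          rw [hc.eq, mul_assoc, ih hlL, mul_zero]
    apply h
    · obtain ⟨a, L, haL⟩ : ∃ a L, hE.toFinset.toList = a :: L := by
        refine List.exists_cons_of_ne_nil fun h0 => ?_
        simp only [Finset.toList_eq_nil, Set.Finite.toFinset_eq_empty] at h0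
        exact hne.ne_empty h0
      have ha : a ∈ E := by
        have : a ∈ hE.toFinset.toList := by simp [haL]
        simpa using this
      rw [haL, List.map_cons, List.prod_cons, ← mul_assoc, mul_sub, hrv a ha,
        (ht.vertex_projection v hv).2]
    · intro l hl
      have h1 : star (t l) * (t l * star (t l)) = star (t l) := by
        have := congrArg star (ht.partialIsometry l)
        simpa [mul_assoc] using this
      rw [← h1, mul_assoc, key _ l hl (by simpa using hl), mul_zero]

theorem IsCK13.isCKFamily_of_edges (hΛ : Λ.FinitelyAligned) (ht : IsCK13 Λ t)
    (h : ∀ v, Λ.IsVertex v → ∀ E : Set Λ.Path, E.Finite →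
      E ⊆ {e | Λ.rng e = v ∧ Λ.IsEdge e} → Λ.Exhaustive v E →
      setProd E (fun l => t v - t l * star (t l)) = 0) : IsCKFamily Λ t := by
  refine ⟨ht, ?_⟩
  have hne : ∀ v (E : Set Λ.Path), Λ.IsVertex v → Λ.Exhaustive v E → E.Nonempty := by
    intro v E hv hE
    obtain ⟨l, hl, -⟩ := hE v (Λ.rng_eq_of_deg_zero v hv)
    exact ⟨l, hl⟩
  suffices H : ∀ (N : Fin k → ℕ) v (E : Set Λ.Path), Λ.IsVertex v → E ⊆ Λ.withRange v →
      E.Finite → Λ.Exhaustive v E → (∀ l ∈ E, Λ.deg l ≤ N) →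
      ∀ x, t v * x = x → (∀ l ∈ E, star (t l) * x = 0) → x = 0 by
    intro v E hv hEv hEf hE
    rw [ht.setProd_eq_zero_iff hΛ hv hEf (hne v E hv hE) hEv]
    refine H (∑ l ∈ hEf.toFinset, Λ.deg l) v E hv hEv hEf hE fun l hl => ?_
    exact Finset.single_le_sum (f := Λ.deg) (fun _ _ _ => Nat.zero_le _)
      (hEf.mem_toFinset.2 hl)
  intro N
  induction N using WellFoundedLT.induction with
  | ind N ih =>
  intro v E hv hEv hEf hE hN x hx hxE
  by_cases hvE : v ∈ E
  · rw [← hxE v hvE, (ht.vertex_projection v hv).1, hx]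
  have hnv : ∀ l ∈ E, ¬ Λ.IsVertex l := by
    intro l hl hlv
    have h1 : Λ.rng l = v := hEv hl
    rw [Λ.rng_eq_of_deg_zero l hlv] at h1
    exact hvE (h1 ▸ hl)
  have hfac : ∀ l, ∃ e m, l ∈ E → Λ.IsEdge e ∧ Λ.src e = Λ.rng m ∧ Λ.comp e m = l := by
    intro l
    by_cases hl : l ∈ E
    · obtain ⟨e, m, h⟩ := exists_edge_factor l (hnv l hl)
      exact ⟨e, m, fun _ => h⟩
    · exact ⟨l, l, fun h => absurd h hl⟩
  choose f g hfg using hfac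
  have hfv : ∀ l ∈ E, Λ.rng (f l) = v := fun l hl => by
    rw [← Λ.rng_comp _ _ (hfg l hl).2.1, (hfg l hl).2.2]
    exact hEv hl
  have hI : Λ.Exhaustive v (f '' E) :=
    hE.image_initial (fun l hl => (hfg l hl).2.1) (fun l hl => (hfg l hl).2.2)
  have hIv : f '' E ⊆ {e | Λ.rng e = v ∧ Λ.IsEdge e} := by
    rintro _ ⟨l, hl, rfl⟩
    exact ⟨hfv l hl, (hfg l hl).1⟩
  refine (ht.setProd_eq_zero_iff hΛ hv (hEf.image f) (hne _ _ hv hI)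
    fun e he => (hIv he).1).1 (h v hv _ (hEf.image f) hIv hI) x hx ?_
  rintro _ ⟨l, hl, rfl⟩
  obtain ⟨⟨i, hi⟩, hs, hc⟩ := hfg l hl
  have hNi : 1 ≤ N i := by
    have : Λ.deg l i ≤ N i := hN l hl i
    rw [← hc, Λ.deg_comp _ _ hs, hi, Pi.add_apply, Pi.single_eq_same] at this
    omega
  refine ih (N - Pi.single i 1) ?_ (Λ.src (f l)) (extSet E (f l)) (Λ.deg_src _)
    (extSet_subset_withRange _ _) (hΛ.finite_extSet hEf _) (hE.extSet (hfv l hl)) ?_ _ ?_ ?_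
  · refine Pi.lt_def.2 ⟨tsub_le_self, i, ?_⟩
    simp only [Pi.sub_apply, Pi.single_eq_same]
    omega
  · rintro a ⟨m, hm, b, hab⟩ j
    have h1 := congrFun (deg_fst_of_mem_minExt hab) j
    have h2 : Λ.deg m j ≤ N j := hN m hm j
    rw [hi] at h1
    change Λ.deg a j ≤ (N - Pi.single i 1 : Fin k → ℕ) j
    simp only [Pi.add_apply, Pi.sup_apply, Pi.sub_apply] at h1 ⊢
    by_cases hj : j = i
    · subst hj
      simp only [Pi.single_eq_same] at h1 ⊢
      omega
    · simp only [Pi.single_eq_of_ne hj] at h1 ⊢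
      omega
  · rw [← mul_assoc, ht.vertex_mul_star]
  · rintro a ⟨m, hm, b, hab⟩
    have h3 : Λ.comp (f l) a = Λ.comp m b := hab.2.2.1
    rw [← mul_assoc, ← star_mul, ht.comp_mul _ _ hab.1, h3, ← ht.comp_mul _ _ hab.2.1, star_mul,
      mul_assoc, hxE m hm, mul_zero]

theorem isCK13_of_edges (hΛ : Λ.FinitelyAligned)
    (hiso : ∀ e, Λ.IsEdge e → t e * star (t e) * t e = t e)
    (hproj : ∀ v, Λ.IsVertex v → star (t v) = t v ∧ t v * t v = t v)
    (horth : ∀ v w, Λ.IsVertex v → Λ.IsVertex w → v ≠ w → t v * t w = 0)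
    (hrng : ∀ e, Λ.IsEdge e → t (Λ.rng e) * t e = t e * t (Λ.src e))
    (hck3 : ∀ e f, Λ.IsEdge e → Λ.IsEdge f → CK3At t e f)
    {T : Λ.Path → A} (hTv : ∀ v, Λ.IsVertex v → T v = t v)
    (hTe : ∀ e m, Λ.IsEdge e → Λ.src e = Λ.rng m → T (Λ.comp e m) = t e * T m) :
    IsCK13 Λ T ∧ ∀ e, Λ.IsEdge e → T e = t e := by
  have hes : ∀ e, Λ.IsEdge e → t e * t (Λ.src e) = t e := by
    intro e he
    have h1 := hck3 e e he he
    obtain ⟨h2, h3⟩ := hproj (Λ.src e) (Λ.deg_src e)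
    rw [CK3At, minExt_self, setSum_singleton, h2, h3] at h1
    rw [← h1, ← mul_assoc, hiso e he]
  have hTE : ∀ e, Λ.IsEdge e → T e = t e := by
    intro e he
    have := hTe e (Λ.src e) he (rng_src e).symm
    rwa [Λ.comp_src_self, hTv _ (Λ.deg_src e), hes e he] at this
  have hTr : ∀ l, T (Λ.rng l) * T l = T l := by
    refine edge_induction (fun v hv => ?_) fun e m he hem _ => ?_
    · rw [Λ.rng_eq_of_deg_zero v hv, hTv v hv, (hproj v hv).2]
    · rw [Λ.rng_comp _ _ hem, hTe e m he hem, hTv _ (Λ.deg_rng e), ← mul_assoc, hrng e he,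
        hes e he]
  have hTs : ∀ l, T l * T (Λ.src l) = T l := by
    refine edge_induction (fun v hv => ?_) fun e m he hem ih => ?_
    · rw [Λ.src_eq_of_deg_zero v hv, hTv v hv, (hproj v hv).2]
    · rw [Λ.src_comp _ _ hem, hTe e m he hem, mul_assoc, ih]
  have hmul : ∀ l m, Λ.src l = Λ.rng m → T l * T m = T (Λ.comp l m) := by
    refine edge_induction (fun v hv m hm => ?_) fun e n he hen ih m hm => ?_
    · rw [Λ.src_eq_of_deg_zero v hv] at hm
      rw [hm, hTr, Λ.rng_comp_self]
    · rw [Λ.src_comp _ _ hen] at hm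
      rw [hTe e n he hen, mul_assoc, ih m hm, Λ.comp_assoc _ _ _ hen hm,
        hTe _ _ he (hen.trans (Λ.rng_comp _ _ hm).symm)]
  have hTproj : ∀ v, Λ.IsVertex v → star (T v) = T v ∧ T v * T v = T v := fun v hv => by
    rw [hTv v hv]; exact hproj v hv
  have hTorth : ∀ v w, Λ.IsVertex v → Λ.IsVertex w → v ≠ w → T v * T w = 0 :=
    fun v w hv hw hvw => by rw [hTv v hv, hTv w hw, horth v w hv hw hvw]
  have hckv : ∀ v m, Λ.IsVertex v → CK3At T v m := by
    intro v m hv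
    rw [CK3At, (hTproj v hv).1]
    by_cases hm : v = Λ.rng m
    · subst hm
      rw [minExt_rng, setSum_singleton, hTr, (hTproj _ (Λ.deg_src m)).1, hTs]
    · have : Λ.minExt v m = ∅ := by
        refine Set.eq_empty_of_forall_notMem fun ⟨a, b⟩ hab => hm ?_
        obtain ⟨h1, h2, h3, -⟩ := hab
        have := congrArg Λ.rng h3
        rwa [Λ.rng_comp _ _ h1, Λ.rng_comp _ _ h2, Λ.rng_eq_of_deg_zero v hv] at this
      rw [this, setSum_empty, ← hTr m, ← mul_assoc, hTorth v _ hv (Λ.deg_rng m) hm, zero_mul]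
  have hTVE : ∀ l, Λ.IsVertex l ∨ Λ.IsEdge l → T l = t l := fun l hl =>
    hl.elim (hTv l) (hTE l)
  have hcke : ∀ e f, Λ.IsEdge e → Λ.IsVertex f ∨ Λ.IsEdge f → CK3At T e f := by
    rintro e f he (hf | hf)
    · exact (hckv f e hf).symm hΛ
    · rw [CK3At, hTE e he, hTE f hf, hck3 e f he hf]
      refine setSum_congr ?_
      rintro ⟨a, b⟩ hab
      rw [hTVE a (fst_vertex_or_edge_of_mem_minExt hab (Or.inr hf)),
        hTVE b (snd_vertex_or_edge_of_mem_minExt hab (Or.inr he))]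
  have hck1 : ∀ l x, Λ.IsVertex x ∨ Λ.IsEdge x → CK3At T l x := by
    refine edge_induction (fun v hv x _ => hckv v x hv) fun e m he hem ih x hx => ?_
    exact (hcke e x he hx).comp hΛ hmul hem fun a b hab =>
      ih a (fst_vertex_or_edge_of_mem_minExt hab hx)
  have hck : ∀ l m, CK3At T l m := by
    refine edge_induction (fun v hv x => hckv v x hv) fun e m he hem ih x => ?_
    exact ((hck1 x e (Or.inr he)).symm hΛ).comp hΛ hmul hem fun a b _ => ih a
  refine ⟨⟨fun l => ?_, hTproj, hTorth, hmul, hck⟩, hTE⟩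
  have h1 := hck l l
  obtain ⟨h2, h3⟩ := hTproj (Λ.src l) (Λ.deg_src l)
  rw [CK3At, minExt_self, setSum_singleton, h2, h3] at h1
  rw [mul_assoc, h1, hTs]

theorem IsCK13.ext_of_edges {t₁ t₂ : Λ.Path → A} (h₁ : IsCK13 Λ t₁) (h₂ : IsCK13 Λ t₂)
    (h : ∀ l, Λ.IsVertex l ∨ Λ.IsEdge l → t₁ l = t₂ l) : t₁ = t₂ := by
  funext l
  induction l using edge_induction with
  | hv v hv => exact h v (Or.inl hv)
  | he e m he hem ih => rw [← h₁.comp_mul e m hem, ← h₂.comp_mul e m hem, h e (Or.inr he), ih]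

end Families

end KGraph

/-- a family of partial isometries indexed by the edges and vertices
extends to at most one Cuntz–Krieger `Λ`-family, and such an extension exists iff
conditions (i)–(iv) hold. -/
theorem stmt19 {k : ℕ} (Λ : KGraph k) (hΛ : Λ.FinitelyAligned)
    {A : Type*} [CStarAlgebra A] (t : Λ.Path → A)
    (ht : ∀ l, Λ.IsVertex l ∨ Λ.IsEdge l → t l * star (t l) * t l = t l) :
    (∀ t₁ t₂ : Λ.Path → A, Λ.IsCKFamily t₁ → Λ.IsCKFamily t₂ →
      (∀ l, Λ.IsVertex l ∨ Λ.IsEdge l → t₁ l = t l) →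
      (∀ l, Λ.IsVertex l ∨ Λ.IsEdge l → t₂ l = t l) →
      t₁ = t₂) ∧
    ((∃ t' : Λ.Path → A, Λ.IsCKFamily t' ∧
        ∀ l, Λ.IsVertex l ∨ Λ.IsEdge l → t' l = t l) ↔
      ((∀ v, Λ.IsVertex v → star (t v) = t v ∧ t v * t v = t v) ∧
       (∀ v w, Λ.IsVertex v → Λ.IsVertex w → v ≠ w → t v * t w = 0) ∧
       (∀ l m a b : Λ.Path,
          Λ.IsVertex l ∨ Λ.IsEdge l → Λ.IsVertex m ∨ Λ.IsEdge m →
          Λ.IsVertex a ∨ Λ.IsEdge a → Λ.IsVertex b ∨ Λ.IsEdge b →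
          Λ.src l = Λ.rng a → Λ.src m = Λ.rng b → Λ.comp l a = Λ.comp m b →
          t l * t a = t m * t b) ∧
       (∀ l m, Λ.IsEdge l → Λ.IsEdge m →
          star (t l) * t m = setSum (Λ.minExt l m) fun p => t p.1 * star (t p.2)) ∧
       (∀ v, Λ.IsVertex v → ∀ E : Set Λ.Path, E.Finite →
          E ⊆ {e | Λ.rng e = v ∧ Λ.IsEdge e} → Λ.Exhaustive v E →
          setProd E (fun l => t v - t l * star (t l)) = 0))) := by
  refine ⟨fun t₁ t₂ h₁ h₂ e₁ e₂ => h₁.toIsCK13.ext_of_edges h₂.toIsCK13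
    fun l hl => (e₁ l hl).trans (e₂ l hl).symm, ?_, ?_⟩
  · rintro ⟨T, hT, hTt⟩
    refine ⟨fun v hv => ?_, fun v w hv hw => ?_, ?_, fun l m hl hm => ?_,
      fun v hv E hEf hEv hE => ?_⟩
    · rw [← hTt v (Or.inl hv)]
      exact hT.vertex_projection v hv
    · rw [← hTt v (Or.inl hv), ← hTt w (Or.inl hw)]
      exact hT.vertex_orthogonal v w hv hw
    · intro l m a b hl hm ha hb hla hmb h
      rw [← hTt l hl, ← hTt m hm, ← hTt a ha, ← hTt b hb, hT.comp_mul l a hla,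
        hT.comp_mul m b hmb, h]
    · rw [← hTt l (Or.inr hl), ← hTt m (Or.inr hm), hT.ck3]
      refine setSum_congr ?_
      rintro ⟨a, b⟩ hab
      rw [hTt a (KGraph.fst_vertex_or_edge_of_mem_minExt hab (Or.inr hm)),
        hTt b (KGraph.snd_vertex_or_edge_of_mem_minExt hab (Or.inr hl))]
    · rw [← hT.ck4 v E hv (fun e he => (hEv he).1) hEf hE]
      refine setProd_congr fun e he => ?_
      rw [hTt v (Or.inl hv), hTt e (Or.inr (hEv he).2)]
  · rintro ⟨hproj, horth, hcomp, hck3, hck4⟩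
    obtain ⟨T, hTv, hTe⟩ := KGraph.exists_edge_mul (t := t)
      fun e f a b he hf ha hb => hcomp e f a b (Or.inr he) (Or.inr hf) (Or.inr ha) (Or.inr hb)
    obtain ⟨hT, hTE⟩ := KGraph.isCK13_of_edges hΛ (fun e he => ht e (Or.inr he)) hproj horth
      (fun e he => hcomp (Λ.rng e) e e (Λ.src e) (Or.inl (Λ.deg_rng e)) (Or.inr he) (Or.inr he)
        (Or.inl (Λ.deg_src e)) (KGraph.src_rng e) (KGraph.rng_src e).symm
        (by rw [Λ.rng_comp_self, Λ.comp_src_self])) hck3 hTv hTe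
    refine ⟨T, hT.isCKFamily_of_edges hΛ fun v hv E hEf hEv hE => ?_,
      fun l hl => hl.elim (hTv l) (hTE l)⟩
    rw [← hck4 v hv E hEf hEv hE]
    refine setProd_congr fun e he => ?_
    rw [hTv v hv, hTE e (hEv he).2]
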